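/- In the ring K = Z_3⟨a, b ∣ a² + b − b² = 0⟩, the element b does not belong to the subring Z⟨c⟩ generated by the element c = a − b. -/

import Mathlib

/-- `nupow a n` represents the power `a ^ (n + 1)` in a (possibly non-unital) multiplicative
structure. -/
def nupow {K : Type*} [Mul K] (a : K) : ℕ → K
  | 0 => a
  | n + 1 => nupow a n * a

/-- Evaluation at `a ∈ K` of a one-variable polynomial over `ZMod p` with zero constant term;
coefficients act through their natural-number representatives (`ZMod.val`), which is the
natural action on a ring of characteristic `p`. -/
noncomputable def pEval {p : ℕ} {K : Type*} [NonUnitalNonAssocRing K]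
    (f : Polynomial (ZMod p)) (a : K) : K :=
  ∑ i ∈ f.support, (f.coeff i).val • (if i = 0 then 0 else nupow a (i - 1))

/-- Evaluation of the monomial `x ^ m 0 * y ^ m 1` at `(a, b)` (zero if `m = 0`). -/
noncomputable def monEval {K : Type*} [Mul K] [Zero K] (a b : K) (m : Fin 2 →₀ ℕ) : K :=
  if m 0 = 0 then (if m 1 = 0 then 0 else nupow b (m 1 - 1))
  else (if m 1 = 0 then nupow a (m 0 - 1) else nupow a (m 0 - 1) * nupow b (m 1 - 1))

/-- Evaluation at `(a, b) ∈ K × K` of a two-variable polynomial over `ZMod p` with zero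
constant term. -/
noncomputable def mvEval {p : ℕ} {K : Type*} [NonUnitalNonAssocRing K]
    (a b : K) (f : MvPolynomial (Fin 2) (ZMod p)) : K :=
  ∑ m ∈ f.support, (MvPolynomial.coeff m f).val • monEval a b m

/-- An element `a` of a ring of characteristic `p` is integral (algebraic over `Z_p`) if it is a
root of some nonzero polynomial over `Z_p` with zero constant term. -/
noncomputable def IsAlgebraicElt (p : ℕ) {K : Type*} [NonUnitalNonAssocRing K] (a : K) : Prop :=
  ∃ f : Polynomial (ZMod p), f ≠ 0 ∧ f.coeff 0 = 0 ∧ pEval f a = 0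

/-- An element is transcendental if it is not a root of any nonzero polynomial over `Z_p`
with zero constant term. -/
noncomputable def IsTranscendentalElt (p : ℕ) {K : Type*} [NonUnitalNonAssocRing K]
    (a : K) : Prop :=
  ∀ f : Polynomial (ZMod p), f ≠ 0 → f.coeff 0 = 0 → pEval f a ≠ 0

/-- A two-variable polynomial over `Z_p` is monic in the variable `i` if, viewed as a polynomial
in the variable `i`, its leading coefficient is `1`. -/
def MonicInVar {p : ℕ} (f : MvPolynomial (Fin 2) (ZMod p)) (i : Fin 2) : Prop :=
  MvPolynomial.coeff (Finsupp.single i (f.degreeOf i)) f = 1 ∧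
    ∀ m ∈ f.support, m i = f.degreeOf i → m = Finsupp.single i (f.degreeOf i)

/-- Two elements `a, b` of a ring of prime characteristic `p` are integrally dependent if
`f (a, b) = 0` for some polynomial `f ∈ Z_p[x, y]` with zero constant term that is monic as a
polynomial in `x` and monic as a polynomial in `y`. -/
noncomputable def IntegrallyDependent (p : ℕ) {K : Type*} [NonUnitalNonAssocRing K]
    (a b : K) : Prop :=
  ∃ f : MvPolynomial (Fin 2) (ZMod p), MvPolynomial.constantCoeff f = 0 ∧
    MonicInVar f 0 ∧ MonicInVar f 1 ∧ mvEval a b f = 0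

/-- A (not necessarily unital) ring `K` is finitely separable if every element `a ∉ A`, where
`A` is a (not necessarily unital) subring, can be separated from `A` by a homomorphism to a
finite ring. -/
def FinitelySeparable (K : Type*) [NonUnitalNonAssocRing K] : Prop :=
  ∀ (a : K) (A : NonUnitalSubring K), a ∉ A →
    ∃ (F : Type) (_ : NonUnitalRing F) (_ : Finite F) (φ : K →ₙ+* F),
      φ a ∉ φ '' (A : Set K)

/-- The `k`-torsion ideal `I_k = {a ∈ K : k • a = 0}` of `K`, as an additive subgroup. -/
def torsionAddSubgroup (K : Type*) [NonUnitalNonAssocRing K] (k : ℕ) : AddSubgroup K where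
  carrier := {a | k • a = 0}
  add_mem' := by
    intro a b ha hb
    simp only [Set.mem_setOf_eq, smul_add] at *
    rw [ha, hb, add_zero]
  zero_mem' := by simp
  neg_mem' := by
    intro a ha
    simp only [Set.mem_setOf_eq, smul_neg] at *
    rw [ha, neg_zero]

/-- The `k`-torsion ideal `I_k = {a ∈ K : k • a = 0}` of a commutative ring `K`, as a
non-unital subring (it is in fact an ideal). -/
def torsionSubring (K : Type*) [NonUnitalCommRing K] (k : ℕ) : NonUnitalSubring K where
  carrier := {a | k • a = 0}
  add_mem' := by
    intro a b ha hb
    simp only [Set.mem_setOf_eq, smul_add] at *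
    rw [ha, hb, add_zero]
  zero_mem' := by simp
  neg_mem' := by
    intro a ha
    simp only [Set.mem_setOf_eq, smul_neg] at *
    rw [ha, neg_zero]
  mul_mem' := by
    intro a b ha hb
    simp only [Set.mem_setOf_eq] at *
    rw [← smul_mul_assoc, ha, zero_mul]

/-- The non-unital ring of polynomials in two variables over `Z_p` with zero constant term. -/
def zeroConstSubring (p : ℕ) : NonUnitalSubring (MvPolynomial (Fin 2) (ZMod p)) where
  carrier := {f | MvPolynomial.constantCoeff f = 0}
  add_mem' := by intro f g hf hg; simp_all [Set.mem_setOf_eq, map_add]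
  zero_mem' := by simp
  neg_mem' := by intro f hf; simp_all [Set.mem_setOf_eq]
  mul_mem' := by intro f g hf hg; simp_all [Set.mem_setOf_eq, map_mul]

lemma mem_zeroConstSubring (p : ℕ) (f : MvPolynomial (Fin 2) (ZMod p)) :
    f ∈ zeroConstSubring p ↔ MvPolynomial.constantCoeff f = 0 := Iff.rfl

/-- The ring `Z_p⟨a, b ∣ f (a, b) = 0⟩`: the quotient of the non-unital ring of two-variable
polynomials over `Z_p` with zero constant term by the (two-sided) ideal generated by `f`. -/
noncomputable def relRing (p : ℕ) (f : MvPolynomial (Fin 2) (ZMod p))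
    (hf : MvPolynomial.constantCoeff f = 0) : Type :=
  (TwoSidedIdeal.span {(⟨f, hf⟩ : zeroConstSubring p)}).ringCon.Quotient

noncomputable instance (p : ℕ) (f : MvPolynomial (Fin 2) (ZMod p))
    (hf : MvPolynomial.constantCoeff f = 0) : NonUnitalRing (relRing p f hf) := by
  unfold relRing; infer_instance

/-- The image `a` of the variable `x` in `Z_p⟨a, b ∣ f (a, b) = 0⟩`. -/
noncomputable def relRingA (p : ℕ) (f : MvPolynomial (Fin 2) (ZMod p))
    (hf : MvPolynomial.constantCoeff f = 0) : relRing p f hf :=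
  ((⟨MvPolynomial.X 0, by rw [mem_zeroConstSubring]; simp⟩ : zeroConstSubring p) :
    (TwoSidedIdeal.span {(⟨f, hf⟩ : zeroConstSubring p)}).ringCon.Quotient)

/-- The image `b` of the variable `y` in `Z_p⟨a, b ∣ f (a, b) = 0⟩`. -/
noncomputable def relRingB (p : ℕ) (f : MvPolynomial (Fin 2) (ZMod p))
    (hf : MvPolynomial.constantCoeff f = 0) : relRing p f hf :=
  ((⟨MvPolynomial.X 1, by rw [mem_zeroConstSubring]; simp⟩ : zeroConstSubring p) :
    (TwoSidedIdeal.span {(⟨f, hf⟩ : zeroConstSubring p)}).ringCon.Quotient)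

lemma relPoly_mem (p : ℕ) :
    MvPolynomial.constantCoeff
      (MvPolynomial.X 0 ^ 2 + MvPolynomial.X 1 - MvPolynomial.X 1 ^ 2 :
        MvPolynomial (Fin 2) (ZMod p)) = 0 := by
  simp

/-- The ring `Z_p⟨a, b ∣ a² + b − b² = 0⟩`. -/
noncomputable def exK (p : ℕ) : Type :=
  relRing p (MvPolynomial.X 0 ^ 2 + MvPolynomial.X 1 - MvPolynomial.X 1 ^ 2) (relPoly_mem p)

noncomputable instance (p : ℕ) : NonUnitalRing (exK p) := by
  unfold exK; infer_instance

/-- The generator `a` of `Z_p⟨a, b ∣ a² + b − b² = 0⟩`. -/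
noncomputable def exA (p : ℕ) : exK p :=
  relRingA p (MvPolynomial.X 0 ^ 2 + MvPolynomial.X 1 - MvPolynomial.X 1 ^ 2) (relPoly_mem p)

/-- The generator `b` of `Z_p⟨a, b ∣ a² + b − b² = 0⟩`. -/
noncomputable def exB (p : ℕ) : exK p :=
  relRingB p (MvPolynomial.X 0 ^ 2 + MvPolynomial.X 1 - MvPolynomial.X 1 ^ 2) (relPoly_mem p)

/-- A ring homomorphism on the unital polynomial ring that kills `f` induces a homomorphism on
`Z_p⟨a, b ∣ f (a, b) = 0⟩`. -/
noncomputable def relRingLift {p : ℕ} {f : MvPolynomial (Fin 2) (ZMod p)}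
    (hf : MvPolynomial.constantCoeff f = 0) {R : Type*} [NonAssocRing R]
    (g : MvPolynomial (Fin 2) (ZMod p) →+* R) (hg : g f = 0) : relRing p f hf →ₙ+* R :=
  let I := TwoSidedIdeal.span {(⟨f, hf⟩ : zeroConstSubring p)}
  let φ : zeroConstSubring p →ₙ+* R :=
    (g : MvPolynomial (Fin 2) (ZMod p) →ₙ+* R).comp
      (NonUnitalSubringClass.subtype (zeroConstSubring p))
  have hI : I ≤ TwoSidedIdeal.ker φ :=
    TwoSidedIdeal.span_le.2 <| Set.singleton_subset_iff.2 <| (TwoSidedIdeal.mem_ker φ).2 hg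
  let lift : I.ringCon.Quotient →ₙ+* R :=
    { toFun := Quotient.lift φ fun _ _ h =>
        TwoSidedIdeal.ker_ringCon φ |>.1 (TwoSidedIdeal.ringCon_le_iff.1 hI h)
      map_zero' := map_zero φ
      map_add' := by rintro ⟨x⟩ ⟨y⟩; exact map_add φ x y
      map_mul' := by rintro ⟨x⟩ ⟨y⟩; exact map_mul φ x y }
  lift

open PowerSeries in
/-- The power series `c² / (c - 1)` is not a polynomial in `c`. -/
theorem polynomial_coe_ne_neg_X_sq_mul_mk_one {R : Type*} [CommRing R] [Nontrivial R]
    (q : Polynomial R) : (q : R⟦X⟧) ≠ -(X ^ 2 * mk 1) := by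
  intro h
  have key : ((q * (1 - Polynomial.X) : Polynomial R) : R⟦X⟧) =
      ((-Polynomial.X ^ 2 : Polynomial R) : R⟦X⟧) := by
    push_cast
    rw [h]
    linear_combination (-X ^ 2 : R⟦X⟧) * mk_one_mul_one_sub_eq_one R
  have := congrArg (Polynomial.eval 1) (Polynomial.coe_injective R key)
  simp at this

open PowerSeries in
/-- There is a homomorphism `Z_3⟨a, b ∣ a² + b − b² = 0⟩ → Z_3⟦c⟧` sending `a - b` to `c` and
`b` to `c² / (c - 1)`. -/
theorem exists_exK_hom_powerSeries :
    ∃ φ : exK 3 →ₙ+* (ZMod 3)⟦X⟧, φ (exA 3 - exB 3) = X ∧ φ (exB 3) = -(X ^ 2 * mk 1) := by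
  have h3 : (3 : (ZMod 3)⟦X⟧) = 0 := by
    rw [← map_ofNat (C (R := ZMod 3)) 3]
    exact map_zero _
  let y : (ZMod 3)⟦X⟧ := -(X ^ 2 * mk 1)
  let g : MvPolynomial (Fin 2) (ZMod 3) →ₐ[ZMod 3] (ZMod 3)⟦X⟧ := MvPolynomial.aeval ![X + y, y]
  have hg : (g : MvPolynomial (Fin 2) (ZMod 3) →+* (ZMod 3)⟦X⟧)
      (MvPolynomial.X 0 ^ 2 + MvPolynomial.X 1 - MvPolynomial.X 1 ^ 2) = 0 := by
    simp only [RingHom.coe_coe, map_sub, map_add, map_pow, g, MvPolynomial.aeval_X,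
      Matrix.cons_val_zero, Matrix.cons_val_one, y]
    linear_combination (-X ^ 2 : (ZMod 3)⟦X⟧) * mk_one_mul_one_sub_eq_one (ZMod 3)
      - X ^ 3 * mk 1 * h3
  let φ : exK 3 →ₙ+* (ZMod 3)⟦X⟧ := relRingLift (relPoly_mem 3) _ hg
  have hA : φ (exA 3) = X + y := MvPolynomial.aeval_X ![X + y, y] 0
  have hB : φ (exB 3) = y := MvPolynomial.aeval_X ![X + y, y] 1
  exact ⟨φ, by rw [map_sub, hA, hB, add_sub_cancel_right], hB⟩

/-- In the ring `K = Z_3⟨a, b ∣ a² + b − b² = 0⟩`, the element `b` does not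
belong to the subring `Z⟨c⟩` generated by the element `c = a − b`. -/
theorem stmt13 : exB 3 ∉ NonUnitalSubring.closure ({exA 3 - exB 3} : Set (exK 3)) := by
  obtain ⟨φ, hc, hb⟩ := exists_exK_hom_powerSeries
  intro h
  let S := (Polynomial.coeToPowerSeries.ringHom (R := ZMod 3)).range.toNonUnitalSubring
  have hle : NonUnitalSubring.closure {exA 3 - exB 3} ≤ S.comap φ :=
    NonUnitalSubring.closure_le.2 <| Set.singleton_subset_iff.2
      ⟨Polynomial.X, by simp [hc]⟩
  obtain ⟨q, hq⟩ := hle h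
  exact polynomial_coe_ne_neg_X_sq_mul_mk_one q (hq.trans hb)
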